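/- arXiv:2501.13701 — 2 statements merged into one kernel-verified Lean document; each statement's English description precedes it below -/
import Mathlib

section
/- Let G be a connected simple graph on a finite vertex type V and H a connected simple graph on a finite vertex type W, and suppose G and H are orbitally similar via orbit enumerations O : Fin ℓ → Finset V of G and Q : Fin ℓ → Finset W of H with a common orbit divisor matrix S. Then G and H have the same entropy: -∑_{i} ((O i).card / Fintype.card V : ℝ) * Real.log ((O i).card / Fintype.card V) = -∑_{i} ((Q i).card / Fintype.card W : ℝ) * Real.log ((Q i).card / Fintype.card W). -/
open Classical Finset

/-- `O : Fin ℓ → Finset V` is an orbit enumeration of the graph `G`: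
every vertex lies in exactly one `O i`, and each `O i` is an orbit of the
automorphism group of `G` acting on the vertices. -/
def IsOrbitEnum {V : Type*} (G : SimpleGraph V) {ℓ : ℕ} (O : Fin ℓ → Finset V) : Prop :=
  (∀ v : V, ∃! i, v ∈ O i) ∧
  ∀ i : Fin ℓ, ∃ w : V, ∀ v : V, v ∈ O i ↔ ∃ φ : G ≃g G, φ w = v

/-- `S` is the orbit divisor matrix of `G` relative to the orbit enumeration `O`:
for every vertex `u ∈ O i`, the number of vertices of `O j` adjacent to `u` is `S i j`. -/
def IsOrbitDivisorMatrix {V : Type*} (G : SimpleGraph V) {ℓ : ℕ}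
    (O : Fin ℓ → Finset V) (S : Matrix (Fin ℓ) (Fin ℓ) ℕ) : Prop :=
  ∀ i j : Fin ℓ, ∀ u ∈ O i, ((O j).filter fun v => G.Adj u v).card = S i j

/-- Two graphs are orbitally similar if they admit orbit enumerations with a
common orbit divisor matrix. -/
def OrbitallySimilar {V W : Type*} (G : SimpleGraph V) (H : SimpleGraph W) : Prop :=
  ∃ (ℓ : ℕ) (O : Fin ℓ → Finset V) (Q : Fin ℓ → Finset W) (S : Matrix (Fin ℓ) (Fin ℓ) ℕ),
    IsOrbitEnum G O ∧ IsOrbitEnum H Q ∧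
    IsOrbitDivisorMatrix G O S ∧ IsOrbitDivisorMatrix H Q S

theorem IsOrbitEnum.card_pos {V : Type*} {G : SimpleGraph V} {ℓ : ℕ} {O : Fin ℓ → Finset V}
    (hO : IsOrbitEnum G O) (i : Fin ℓ) : 0 < (O i).card := by
  obtain ⟨w, hw⟩ := hO.2 i
  exact Finset.card_pos.mpr ⟨w, (hw w).mpr ⟨SimpleGraph.Iso.refl, rfl⟩⟩

theorem IsOrbitEnum.sum_card {V : Type*} [Fintype V] {G : SimpleGraph V} {ℓ : ℕ}
    {O : Fin ℓ → Finset V} (hO : IsOrbitEnum G O) : ∑ i, (O i).card = Fintype.card V := by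
  rw [← Finset.card_univ, ← Finset.card_biUnion]
  · congr 1
    ext v
    simpa using (hO.1 v).exists
  · intro i _ j _ hij
    exact Finset.disjoint_left.mpr fun v hi hj => hij ((hO.1 v).unique hi hj)

/-- Double counting of the edges between two cells. -/
theorem IsOrbitDivisorMatrix.card_mul_comm {V : Type*} {G : SimpleGraph V} {ℓ : ℕ}
    {O : Fin ℓ → Finset V} {S : Matrix (Fin ℓ) (Fin ℓ) ℕ} (hS : IsOrbitDivisorMatrix G O S)
    (i j : Fin ℓ) : (O i).card * S i j = (O j).card * S j i := by
  refine Finset.card_mul_eq_card_mul G.Adj (fun u hu => ?_) fun v hv => ?_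
  · simpa only [Finset.bipartiteAbove] using hS i j u hu
  · simpa only [Finset.bipartiteBelow, G.adj_comm] using hS j i v hv

theorem IsOrbitDivisorMatrix.ne_zero_of_adj {V : Type*} {G : SimpleGraph V} {ℓ : ℕ}
    {O : Fin ℓ → Finset V} {S : Matrix (Fin ℓ) (Fin ℓ) ℕ} (hS : IsOrbitDivisorMatrix G O S)
    {i j : Fin ℓ} {u v : V} (hu : u ∈ O i) (hv : v ∈ O j) (h : G.Adj u v) : S i j ≠ 0 := by
  rw [← hS i j u hu]
  exact Finset.card_ne_zero_of_mem (Finset.mem_filter.mpr ⟨hv, h⟩)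

/-- Cell sizes of two graphs with a common divisor matrix are proportional along walks. -/
theorem IsOrbitDivisorMatrix.card_mul_card_of_walk {V W : Type*} {G : SimpleGraph V}
    {H : SimpleGraph W} {ℓ : ℕ} {O : Fin ℓ → Finset V} {Q : Fin ℓ → Finset W}
    {S : Matrix (Fin ℓ) (Fin ℓ) ℕ} (hO : IsOrbitEnum G O)
    (hSG : IsOrbitDivisorMatrix G O S) (hSH : IsOrbitDivisorMatrix H Q S)
    {u v : V} (p : G.Walk u v) {i j : Fin ℓ} (hu : u ∈ O i) (hv : v ∈ O j) :
    (O i).card * (Q j).card = (O j).card * (Q i).card := by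
  induction p generalizing i with
  | nil => rw [(hO.1 _).unique hu hv]
  | @cons u w v h p ih =>
    obtain ⟨k, hk, -⟩ := hO.1 w
    have hkj := ih hk hv
    have hik : (O i).card * (Q k).card = (O k).card * (Q i).card := by
      have hpos : S i k * S k i ≠ 0 :=
        mul_ne_zero (hSG.ne_zero_of_adj hu hk h) (hSG.ne_zero_of_adj hk hu h.symm)
      apply mul_right_cancel₀ hpos
      linear_combination (Q k).card * S k i * hSG.card_mul_comm i k
        + (O k).card * S k i * hSH.card_mul_comm k i
    apply mul_left_cancel₀ (hO.card_pos k).ne'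
    linear_combination (O i).card * hkj + (O j).card * hik

/-- Orbitally similar connected graphs have the same entropy. -/
theorem entropy_eq_of_orbitally_similar {V W : Type*} [Fintype V] [Fintype W]
    (G : SimpleGraph V) (H : SimpleGraph W) (hG : G.Connected) (hH : H.Connected)
    {ℓ : ℕ} (O : Fin ℓ → Finset V) (Q : Fin ℓ → Finset W) (S : Matrix (Fin ℓ) (Fin ℓ) ℕ)
    (hO : IsOrbitEnum G O) (hQ : IsOrbitEnum H Q)
    (hSG : IsOrbitDivisorMatrix G O S) (hSH : IsOrbitDivisorMatrix H Q S) :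
    -∑ i : Fin ℓ, ((O i).card / Fintype.card V : ℝ) *
        Real.log ((O i).card / Fintype.card V)
      = -∑ i : Fin ℓ, ((Q i).card / Fintype.card W : ℝ) *
        Real.log ((Q i).card / Fintype.card W) := by
  have := hG.nonempty
  have := hH.nonempty
  have key (i : Fin ℓ) : (O i).card * Fintype.card W = (Q i).card * Fintype.card V := by
    rw [← hO.sum_card, ← hQ.sum_card, Finset.mul_sum, Finset.mul_sum]
    refine Finset.sum_congr rfl fun j _ => ?_
    obtain ⟨u, hu⟩ := Finset.card_pos.mp (hO.card_pos i)
    obtain ⟨v, hv⟩ := Finset.card_pos.mp (hO.card_pos j)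
    obtain ⟨p⟩ := hG.preconnected u v
    rw [hSG.card_mul_card_of_walk hO hSH p hu hv, mul_comm]
  have ratio (i : Fin ℓ) :
      ((O i).card / Fintype.card V : ℝ) = (Q i).card / Fintype.card W := by
    rw [div_eq_div_iff (by simp) (by simp)]
    exact_mod_cast key i
  simp only [ratio]
end

section
/- Let G be a connected simple graph on a finite vertex type V that is a tree (equivalently, G.edgeFinset.card = Fintype.card V - 1), and let H be a connected simple graph on a finite vertex type W that is orbitally similar to G. Then Fintype.card W = Fintype.card V. Consequently, there is no self-similar sequence emanating from a tree. -/
open Classical Finset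

namespace IsOrbitEnum

variable {V : Type*} {G : SimpleGraph V} {ℓ : ℕ} {O : Fin ℓ → Finset V}

theorem nonempty (hO : IsOrbitEnum G O) (i : Fin ℓ) : (O i).Nonempty := by
  obtain ⟨w, hw⟩ := hO.2 i
  exact ⟨w, (hw w).2 ⟨SimpleGraph.Iso.refl, rfl⟩⟩

theorem pairwiseDisjoint (hO : IsOrbitEnum G O) (s : Set (Fin ℓ)) : s.PairwiseDisjoint O := by
  intro i _ j _ hij
  exact Finset.disjoint_left.2 fun v hi hj ↦ hij ((hO.1 v).unique hi hj)

theorem biUnion_eq_univ [Fintype V] [DecidableEq V] (hO : IsOrbitEnum G O) :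
    Finset.univ.biUnion O = Finset.univ := by
  ext v
  simpa using (hO.1 v).exists

theorem sum_eq_sum_sum [Fintype V] {M : Type*} [AddCommMonoid M] (hO : IsOrbitEnum G O)
    (f : V → M) : ∑ v, f v = ∑ i, ∑ v ∈ O i, f v := by
  rw [← hO.biUnion_eq_univ, Finset.sum_biUnion (hO.pairwiseDisjoint _)]

theorem sum_card_s18 [Fintype V] (hO : IsOrbitEnum G O) : ∑ i, (O i).card = Fintype.card V := by
  rw [← Finset.card_univ, ← hO.biUnion_eq_univ, Finset.card_biUnion (hO.pairwiseDisjoint _)]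

end IsOrbitEnum

namespace IsOrbitDivisorMatrix

variable {V : Type*} {G : SimpleGraph V} {ℓ : ℕ} {O : Fin ℓ → Finset V}
  {S : Matrix (Fin ℓ) (Fin ℓ) ℕ}

theorem card_mul_comm_s18 (hS : IsOrbitDivisorMatrix G O S) (i j : Fin ℓ) :
    (O i).card * S i j = (O j).card * S j i := by
  refine Finset.card_mul_eq_card_mul G.Adj (fun u hu ↦ hS i j u hu) fun u hu ↦ ?_
  rw [← hS j i u hu]
  simp only [Finset.bipartiteBelow, G.adj_comm]

theorem pos_of_adj (hS : IsOrbitDivisorMatrix G O S) {i j : Fin ℓ} {u v : V}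
    (hu : u ∈ O i) (hv : v ∈ O j) (h : G.Adj u v) : 0 < S i j := by
  rw [← hS i j u hu]
  exact Finset.card_pos.2 ⟨v, Finset.mem_filter.2 ⟨hv, h⟩⟩

theorem degree_eq [Fintype V] [DecidableRel G.Adj] (hO : IsOrbitEnum G O)
    (hS : IsOrbitDivisorMatrix G O S) {i : Fin ℓ} {u : V} (hu : u ∈ O i) :
    G.degree u = ∑ j, S i j := by
  rw [← G.card_neighborFinset_eq_degree, G.neighborFinset_eq_filter, Finset.card_filter,
    hO.sum_eq_sum_sum]
  refine Finset.sum_congr rfl fun j _ ↦ ?_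
  rw [← hS i j u hu, Finset.card_filter]
  congr!

theorem two_mul_card_edgeFinset [Fintype V] [DecidableRel G.Adj] (hO : IsOrbitEnum G O)
    (hS : IsOrbitDivisorMatrix G O S) :
    2 * G.edgeFinset.card = ∑ i, (O i).card * ∑ j, S i j := by
  rw [← G.sum_degrees_eq_twice_card_edges, hO.sum_eq_sum_sum]
  refine Finset.sum_congr rfl fun i _ ↦ ?_
  rw [Finset.sum_congr rfl fun u hu ↦ degree_eq hO hS hu, Finset.sum_const, smul_eq_mul]

/-- Class sizes of a connected graph are determined up to scaling by the divisor matrix. -/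
theorem card_mul_card_eq {W : Type*} {H : SimpleGraph W} {Q : Fin ℓ → Finset W}
    (hG : G.Connected) (hO : IsOrbitEnum G O) (hS : IsOrbitDivisorMatrix G O S)
    (hT : IsOrbitDivisorMatrix H Q S) (i j : Fin ℓ) :
    (Q i).card * (O j).card = (Q j).card * (O i).card := by
  obtain ⟨u, hu⟩ := hO.nonempty i
  obtain ⟨v, hv⟩ := hO.nonempty j
  have huv := (SimpleGraph.reachable_iff_reflTransGen u v).1 (hG.preconnected u v)
  induction huv generalizing j with
  | refl => rw [(hO.1 u).unique hu hv]
  | @tail w v _ hwv ih =>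
    obtain ⟨k, hk⟩ := (hO.1 w).exists
    have ih := ih k hk
    have hpos := hS.pos_of_adj hv hk hwv.symm
    have hstep : (Q k).card * (O j).card = (Q j).card * (O k).card := by
      refine Nat.eq_of_mul_eq_mul_right hpos ?_
      linear_combination (Q k).card * hS.card_mul_comm_s18 j k + (O k).card * hT.card_mul_comm_s18 k j
    refine Nat.eq_of_mul_eq_mul_right (Finset.card_pos.2 ⟨w, hk⟩) ?_
    linear_combination (O j).card * ih + (O i).card * hstep

end IsOrbitDivisorMatrix

/-- A connected graph orbitally similar to a tree has the same number of
vertices as the tree; consequently there is no self-similar sequence emanating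
from a tree. -/
theorem card_eq_of_orbitally_similar_to_tree {V W : Type*}
    [Fintype V] [Fintype W] [DecidableEq V] [DecidableEq W]
    (G : SimpleGraph V) (H : SimpleGraph W) [DecidableRel G.Adj] [DecidableRel H.Adj]
    (hG : G.Connected) (hH : H.Connected)
    (htree : G.edgeFinset.card = Fintype.card V - 1)
    (hGH : OrbitallySimilar G H) :
    Fintype.card W = Fintype.card V := by
  obtain ⟨ℓ, O, Q, S, hO, hQ, hS, hT⟩ := hGH
  have hscale (i : Fin ℓ) : Fintype.card V * (Q i).card = Fintype.card W * (O i).card := by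
    rw [← hO.sum_card_s18, ← hQ.sum_card_s18, Finset.sum_mul, Finset.sum_mul]
    refine Finset.sum_congr rfl fun j _ ↦ ?_
    rw [mul_comm]
    exact hS.card_mul_card_eq hG hO hT i j
  have hedges : Fintype.card V * H.edgeFinset.card = Fintype.card W * G.edgeFinset.card := by
    refine Nat.eq_of_mul_eq_mul_left two_pos ?_
    rw [mul_left_comm, hT.two_mul_card_edgeFinset hQ, mul_left_comm 2,
      hS.two_mul_card_edgeFinset hO, Finset.mul_sum, Finset.mul_sum]
    refine Finset.sum_congr rfl fun i _ ↦ ?_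
    rw [← mul_assoc, hscale, mul_assoc]
  have hle : Fintype.card W ≤ H.edgeFinset.card + 1 := by
    simpa [Nat.card_eq_fintype_card, SimpleGraph.edgeFinset_card] using
      hH.card_vert_le_card_edgeSet_add_one
  have := hG.nonempty
  have := hH.nonempty
  have hV : 0 < Fintype.card V := Fintype.card_pos
  have hW : 0 < Fintype.card W := Fintype.card_pos
  obtain ⟨n, hn⟩ := Nat.exists_eq_add_one.2 hV
  rw [htree, hn, Nat.add_sub_cancel] at hedges
  rw [hn]
  have hlt : H.edgeFinset.card < Fintype.card W := by
    by_contra! h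
    nlinarith
  have heq : Fintype.card W = H.edgeFinset.card + 1 := by omega
  rw [heq] at hedges ⊢
  linear_combination hedges
end
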